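/- arXiv:2506.22061 — 2 statements merged into one kernel-verified Lean document; each statement's English description precedes it below -/
import Mathlib

section
/- (Fine and Wilf) If words x^k and y^l (for some k, l ∈ ℕ) share a common prefix of length at least |x| + |y| − gcd(|x|, |y|), then x and y are powers of a common word. -/
/-- `wpow w n` is the `n`-fold concatenation (iteration) of the word `w`. -/
def wpow {A : Type*} (w : List A) : ℕ → List A
  | 0 => []
  | n + 1 => w ++ wpow w n

/-- A word is primitive if it cannot be written as `v ^ k` for any `k ≥ 2`. -/
def Primitive {A : Type*} (w : List A) : Prop :=
  ∀ (v : List A) (k : ℕ), 2 ≤ k → w ≠ wpow v k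

theorem wpow_comm_aux {A : Type*} (x : List A) (k : ℕ) :
    x ++ wpow x k = wpow x k ++ x := by
  induction k with
  | zero => simp [wpow]
  | succ k ih => simp only [wpow, List.append_assoc]; rw [← ih]

theorem wpow_length_aux {A : Type*} (x : List A) (k : ℕ) :
    (wpow x k).length = k * x.length := by
  induction k with
  | zero => simp [wpow]
  | succ k ih => simp only [wpow, List.length_append, ih]; ring

theorem wpow_hasPeriod_aux {A : Type*} (x : List A) (k : ℕ) :
    (wpow x k).HasPeriod x.length := by
  cases k with
  | zero => simp [wpow]
  | succ k =>
    simp only [wpow, List.HasPeriod, List.take_left]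
    rw [List.prefix_append_right_inj, wpow_comm_aux]
    exact List.prefix_append _ _

theorem prefix_wpow_aux {A : Type*} (w z : List A) (h : z <+: w ++ z) (n : ℕ) :
    z <+: wpow w n ++ z := by
  induction n with
  | zero => simp [wpow]
  | succ n ih =>
    simp only [wpow, List.append_assoc]
    exact h.trans ((List.prefix_append_right_inj w).2 ih)

theorem prefix_eq_wpow_aux {A : Type*} (w z x : List A) (h : z <+: w ++ z) (hx : x <+: z)
    (m : ℕ) (hm : x.length = m * w.length) : x = wpow w m :=
  (List.prefix_of_prefix_length_le (hx.trans (prefix_wpow_aux w z h m))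
    (List.prefix_append _ _) (by rw [wpow_length_aux, hm])).eq_of_length
    (by rw [wpow_length_aux, hm])

theorem prefix_base_aux {A : Type*} (x z : List A) (k : ℕ) (h : z <+: wpow x k)
    (hl : x.length ≤ z.length) (h0 : 0 < x.length) : x <+: z := by
  cases k with
  | zero =>
    have := h.length_le
    simp [wpow] at this
    subst this
    simp at hl
    simp [hl]
  | succ k => exact List.prefix_of_prefix_length_le (List.prefix_append _ _) h hl

/-- Fine and Wilf: if `x ^ k` and `y ^ l` share a common prefix of length at
least `|x| + |y| - gcd (|x|, |y|)`, then `x` and `y` are powers of a common word. -/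
theorem fine_and_wilf {A : Type*} (x y z : List A) (k l : ℕ)
    (hx : z <+: wpow x k) (hy : z <+: wpow y l)
    (hlen : x.length + y.length - Nat.gcd x.length y.length ≤ z.length) :
    ∃ (w : List A) (m n : ℕ), x = wpow w m ∧ y = wpow w n := by
  rcases Nat.eq_zero_or_pos x.length with hx0 | hx0
  · exact ⟨y, 0, 1, by simpa [wpow] using hx0, by simp [wpow]⟩
  rcases Nat.eq_zero_or_pos y.length with hy0 | hy0
  · exact ⟨x, 1, 0, by simp [wpow], by simpa [wpow] using hy0⟩
  have g1 := Nat.gcd_le_left y.length hx0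
  have g2 := Nat.gcd_le_right x.length hy0
  have per : z.HasPeriod (x.length.gcd y.length) :=
    ((wpow_hasPeriod_aux x k).infix hx.isInfix).gcd
      ((wpow_hasPeriod_aux y l).infix hy.isInfix) hlen
  have hw : (z.take (x.length.gcd y.length)).length = x.length.gcd y.length := by
    rw [List.length_take]; omega
  refine ⟨z.take (x.length.gcd y.length), x.length / x.length.gcd y.length,
    y.length / x.length.gcd y.length, ?_, ?_⟩
  · exact prefix_eq_wpow_aux _ z x per (prefix_base_aux x z k hx (by omega) hx0) _
      (by rw [hw, Nat.div_mul_cancel (Nat.gcd_dvd_left _ _)])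
  · exact prefix_eq_wpow_aux _ z y per (prefix_base_aux y z l hy (by omega) hy0) _
      (by rw [hw, Nat.div_mul_cancel (Nat.gcd_dvd_right _ _)])
end

section
/- (Lyndon–Schützenberger) If x^K = y^L · z^M for words x, y, z and integers K, L, M ≥ 2, then there exists a word α and numbers k, l, m ∈ ℕ such that x = α^k, y = α^l, and z = α^m. -/
section LS

variable {A : Type*}

theorem wpow_add (w : List A) (m n : ℕ) : wpow w (m + n) = wpow w m ++ wpow w n := by
  induction m with
  | zero => simp [wpow]
  | succ k ih => rw [Nat.add_right_comm]; simp [wpow, ih]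

theorem wpow_length (w : List A) (n : ℕ) : (wpow w n).length = n * w.length := by
  induction n with
  | zero => simp [wpow]
  | succ k ih => simp [wpow, ih]; ring

theorem comm_wpow {a b : List A} (h : a ++ b = b ++ a) (n : ℕ) :
    a ++ wpow b n = wpow b n ++ a := by
  induction n with
  | zero => simp [wpow]
  | succ k ih =>
    simp only [wpow]
    rw [← List.append_assoc, h, List.append_assoc, ih, List.append_assoc]

theorem wpow_succ' (w : List A) (n : ℕ) : wpow w (n + 1) = wpow w n ++ w := by
  rw [← comm_wpow rfl]; rfl

theorem wpow_reverse (w : List A) (n : ℕ) : (wpow w n).reverse = wpow w.reverse n := by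
  induction n with
  | zero => simp [wpow]
  | succ k ih => rw [wpow_succ', List.reverse_append, ih]; rfl

theorem wpow_mul (w : List A) (m n : ℕ) : wpow w (m * n) = wpow (wpow w m) n := by
  induction n with
  | zero => simp [wpow]
  | succ k ih => rw [Nat.mul_succ, Nat.add_comm, wpow_add, ih]; rfl

theorem weak_period {a b p : List A} (ha : p <+: a ++ p) (hb : p <+: b ++ p)
    (hl : a.length + b.length ≤ p.length) : a ++ b = b ++ a := by
  have h1 : a <+: p := List.prefix_of_prefix_length_le (List.prefix_append a p) ha (by omega)
  have h2 : b <+: p := List.prefix_of_prefix_length_le (List.prefix_append b p) hb (by omega)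
  have h3 : a ++ b <+: p := List.prefix_of_prefix_length_le
    ((List.prefix_append_right_inj a).2 h2) ha (by simp; omega)
  have h4 : b ++ a <+: p := List.prefix_of_prefix_length_le
    ((List.prefix_append_right_inj b).2 h1) hb (by simp; omega)
  exact (List.prefix_of_prefix_length_le h3 h4 (by simp; omega)).eq_of_length (by simp; omega)

theorem wpow_prefix (b : List A) (n : ℕ) : wpow b n <+: b ++ wpow b n := by
  rw [comm_wpow rfl]; exact List.prefix_append _ _

theorem comm_of_comm_wpow {a b : List A} {n : ℕ} (hn : 1 ≤ n)
    (h : a ++ wpow b n = wpow b n ++ a) : a ++ b = b ++ a := by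
  rcases b with _ | ⟨c, b⟩
  · simp
  · have h' := comm_wpow h (a.length + (c :: b).length)
    rw [← wpow_mul] at h'
    refine weak_period (p := wpow (c :: b) (n * (a.length + (c :: b).length))) ?_
      (wpow_prefix _ _) ?_
    · rw [h']; exact List.prefix_append _ _
    · rw [wpow_length]
      have : 1 ≤ (c :: b).length := by simp
      calc _ = 1 * (a.length + (c :: b).length) * 1 := by ring
        _ ≤ _ := by gcongr

def PairComm (x y z : List A) : Prop := x ++ y = y ++ x ∧ x ++ z = z ++ x ∧ y ++ z = z ++ y

theorem rev_comm {x y : List A} (h : x.reverse ++ y.reverse = y.reverse ++ x.reverse) :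
    x ++ y = y ++ x := by
  have := congrArg List.reverse h
  simpa using this.symm

theorem PairComm.of_reverse {x y z : List A} (h : PairComm x.reverse z.reverse y.reverse) :
    PairComm x y z :=
  ⟨rev_comm h.2.1, rev_comm h.1, (rev_comm h.2.2).symm⟩

theorem eq_reverse {x y z : List A} {K L M : ℕ} (h : wpow x K = wpow y L ++ wpow z M) :
    wpow x.reverse K = wpow z.reverse M ++ wpow y.reverse L := by
  have := congrArg List.reverse h
  simpa [wpow_reverse] using this

/-- If `a` commutes with `p ++ q` and with `p`, it commutes with `q`. -/
theorem comm_cancel {a p q : List A} (h : a ++ (p ++ q) = (p ++ q) ++ a)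
    (hp : a ++ p = p ++ a) : a ++ q = q ++ a := by
  rw [← List.append_assoc, hp, List.append_assoc, List.append_assoc] at h
  exact List.append_cancel_left h

theorem pairComm_of_xy {x y z : List A} {K L M : ℕ} (hM : 1 ≤ M)
    (heq : wpow x K = wpow y L ++ wpow z M) (h : x ++ y = y ++ x) : PairComm x y z := by
  refine ⟨h, ?_, ?_⟩
  · apply comm_of_comm_wpow hM
    apply comm_cancel (p := wpow y L) _ (comm_wpow h L)
    rw [← heq]; exact comm_wpow rfl K
  · apply comm_of_comm_wpow hM
    apply comm_cancel (p := wpow y L) _ (comm_wpow rfl L)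
    rw [← heq]; exact comm_wpow h.symm K

theorem pairComm_of_xz {x y z : List A} {K L M : ℕ} (hL : 1 ≤ L)
    (heq : wpow x K = wpow y L ++ wpow z M) (h : x ++ z = z ++ x) : PairComm x y z := by
  apply PairComm.of_reverse
  exact pairComm_of_xy hL (eq_reverse heq) (rev_comm (by simpa using h))

theorem step_long {x y r : List A} {K L : ℕ} (heq : wpow x K = wpow y L ++ r)
    (hl : x.length + y.length ≤ (wpow y L).length) : x ++ y = y ++ x := by
  refine weak_period (p := wpow y L) ?_ (wpow_prefix _ _) hl
  have h1 : wpow y L <+: wpow x K := ⟨r, heq.symm⟩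
  exact List.prefix_of_prefix_length_le (h1.trans (wpow_prefix x K))
    ((List.prefix_append_right_inj x).2 h1) (by simp)

theorem step_two {x y z : List A} {L M : ℕ} (hL : 2 ≤ L) (hM : 2 ≤ M)
    (IH : ∀ (x' y' z' : List A) (K L M : ℕ), x'.length < x.length → 2 ≤ K → 2 ≤ L → 2 ≤ M →
      wpow x' K = wpow y' L ++ wpow z' M → PairComm x' y' z')
    (heq : wpow x 2 = wpow y L ++ wpow z M) (hx : x.length ≤ (wpow y L).length)
    (hy : (wpow y L).length < x.length + y.length) (hyx : y.length < x.length) :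
    PairComm x y z := by
  have heq' : x ++ x = wpow y L ++ wpow z M := by rw [← heq]; simp [wpow]
  obtain ⟨v, hv⟩ : x <+: wpow y L :=
    List.prefix_of_prefix_length_le (List.prefix_append x x) ⟨_, heq'.symm⟩ hx
  have hxv : x = v ++ wpow z M := by
    rw [← hv, List.append_assoc] at heq'
    exact List.append_cancel_left heq'
  have hvl : v.length < y.length := by
    have := congrArg List.length hv
    simp at this; omega
  obtain ⟨u, hu⟩ : v <+: y := by
    obtain ⟨L', rfl⟩ : ∃ L', L = L' + 1 := ⟨L - 1, by omega⟩
    refine List.prefix_of_prefix_length_le (l₃ := wpow y (L' + 1)) ?_ ⟨wpow y L', rfl⟩ hvl.le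
    rw [← hv, hxv, List.append_assoc]; exact List.prefix_append _ _
  have hconj : ∀ n, v ++ wpow (u ++ v) n = wpow y n ++ v := by
    intro n
    induction n with
    | zero => simp [wpow]
    | succ k ih =>
      simp only [wpow, List.append_assoc]
      rw [ih, ← hu]; simp
  have hnew : wpow (u ++ v) L = wpow z M ++ wpow v 2 := by
    have := hconj L
    rw [← hv, hxv] at this
    simp only [List.append_assoc] at this
    simpa [wpow] using List.append_cancel_left this
  have hlen : (u ++ v).length < x.length := by
    rw [← hu] at hyx; simp at hyx ⊢; omega
  obtain ⟨_, _, h3⟩ := IH _ _ _ _ _ _ hlen hL hM le_rfl hnew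
  apply pairComm_of_xz (by omega) heq
  rw [hxv, List.append_assoc, ← comm_wpow rfl, ← List.append_assoc, ← List.append_assoc, h3]

/-- Every border of `w` is trivial up to commutation. -/
def GoodWord (w : List A) : Prop := ∀ b s t, w = b ++ s → w = t ++ b → s = t

theorem GoodWord.reverse {w : List A} (h : GoodWord w) : GoodWord w.reverse := by
  intro b s t h1 h2
  have h1' := congrArg List.reverse h1
  have h2' := congrArg List.reverse h2
  simp at h1' h2'
  exact (List.reverse_injective (h _ _ _ h2' h1')).symm

theorem lex_append [LinearOrder A] {s t : List A} (h : s < t) (hl : s.length = t.length)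
    (b : List A) : s ++ b < t ++ b := by
  induction s generalizing t with
  | nil => cases t with
    | nil => exact absurd h (lt_irrefl _)
    | cons => simp at hl
  | cons a s ih => cases t with
    | nil => simp at hl
    | cons a' t =>
      simp only [List.cons_append, List.cons_lt_cons_iff] at h ⊢
      simp only [List.length_cons, Nat.add_right_cancel_iff] at hl
      exact h.imp id (fun h => ⟨h.1, ih h.2 hl⟩)

theorem exists_good (x : List A) : ∃ c d, x = c ++ d ∧ GoodWord (d ++ c) := by
  classical
  letI : LinearOrder A := linearOrderOfSTO WellOrderingRel
  let S : Finset (List A) := (Finset.range (x.length + 1)).image x.rotate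
  obtain ⟨w, hw, hmin⟩ := S.exists_min_image id ⟨x.rotate 0, by simp [S]; exact ⟨0, by simp⟩⟩
  have hconj : ∀ w', w' ~r w → w ≤ w' := by
    intro w' hw'
    apply hmin
    simp only [S, Finset.mem_image, Finset.mem_range] at hw ⊢
    obtain ⟨n, hn, rfl⟩ := hw
    have : x ~r w' := (List.IsRotated.forall x n).symm.trans hw'.symm
    obtain ⟨m, hm, h⟩ := List.isRotated_iff_mod.1 this
    exact ⟨m, by omega, h⟩
  simp only [S, Finset.mem_image, Finset.mem_range] at hw
  obtain ⟨n, hn, rfl⟩ := hw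
  refine ⟨x.take n, x.drop n, by simp, ?_⟩
  rw [← List.rotate_eq_drop_append_take (by omega)]
  generalize x.rotate n = w at *
  intro b s t h1 h2
  have hl : s.length = t.length := by
    have := congrArg List.length (h1.symm.trans h2)
    simp at this; omega
  have a1 : b ++ s ≤ b ++ t := by
    rw [← h1]; apply hconj; rw [h2]; exact List.isRotated_append
  have a2 : t ++ b ≤ s ++ b := by
    rw [← h2]; apply hconj; rw [h1]; exact List.isRotated_append
  rcases lt_trichotomy s t with h | h | h
  · exact absurd (lex_append h hl b) (not_lt.2 a2)
  · exact h
  · exact absurd (List.append_left_lt (l₁ := b) h) (not_lt.2 a1)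

theorem step_three {x y r c d : List A} {K L : ℕ} (hK : 2 ≤ K) (hL : 2 ≤ L)
    (heq : wpow x K = wpow y L ++ r) (hx : x = c ++ d) (hg : GoodWord (d ++ c))
    (hl : c.length + x.length ≤ (wpow y L).length) (hyx : y.length < x.length) :
    x ++ y = y ++ x := by
  -- `c ++ w` is a prefix of `y ^ L`, with `w = d ++ c`
  have h0 : c ++ (d ++ c) <+: wpow y L := by
    refine List.prefix_of_prefix_length_le (l₃ := wpow x K) ?_ ⟨r, heq.symm⟩
      (by rw [hx] at hl; simp at hl ⊢; omega)
    obtain ⟨K', rfl⟩ : ∃ K', K = K' + 2 := ⟨K - 2, by omega⟩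
    exact ⟨d ++ wpow x K', by simp [wpow, hx]⟩
  -- the period
  have h1 : c ++ (d ++ c) <+: y ++ (c ++ (d ++ c)) :=
    List.prefix_of_prefix_length_le (h0.trans (wpow_prefix y L))
      ((List.prefix_append_right_inj y).2 h0) (by simp)
  have hwl : (d ++ c).length = x.length := by rw [hx]; simp; omega
  have h2 : c <+: y ++ c := List.prefix_of_prefix_length_le
    ((List.prefix_append c _).trans h1)
    ((List.prefix_append_right_inj y).2 (List.prefix_append c _)) (by simp)
  obtain ⟨t, ht⟩ := h2
  have htl : t.length = y.length := by
    have := congrArg List.length ht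
    simp at this; omega
  have h3 : d ++ c <+: t ++ (d ++ c) := by
    rw [← List.append_assoc y, ← ht, List.append_assoc c t] at h1
    exact (List.prefix_append_right_inj c).1 h1
  obtain ⟨b, hb⟩ : t <+: d ++ c :=
    List.prefix_of_prefix_length_le (List.prefix_append t _) h3 (by omega)
  have h4 : b <+: d ++ c := by
    rw [← hb] at h3
    have h5 := (List.prefix_append_right_inj t).1 h3
    exact List.prefix_of_prefix_length_le h5 (List.prefix_refl _) (by simp)|>.trans
      (by rw [hb])
  obtain ⟨s, hs⟩ := h4
  have hst : s = t := hg b s t hs.symm hb.symm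
  subst hst
  have hw : (d ++ c) ++ s = s ++ (d ++ c) := by
    rw [← hb, List.append_assoc, hs, hb]
  apply List.append_cancel_right (bs := c)
  calc (x ++ y) ++ c = x ++ (y ++ c) := by simp
    _ = c ++ ((d ++ c) ++ s) := by rw [← ht, hx]; simp
    _ = (c ++ s) ++ (d ++ c) := by rw [hw]; simp
    _ = (y ++ x) ++ c := by rw [ht, hx]; simp

theorem ls_aux (n : ℕ) : ∀ (x y z : List A) (K L M : ℕ), x.length < n → 2 ≤ K → 2 ≤ L → 2 ≤ M →
      wpow x K = wpow y L ++ wpow z M → PairComm x y z := by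
  induction n with
  | zero => intro x y z K L M h; omega
  | succ n ih =>
    intro x y z K L M hn hK hL hM heq
    have heqr := eq_reverse heq
    by_cases h1 : x.length + y.length ≤ (wpow y L).length
    · exact pairComm_of_xy (by omega) heq (step_long heq h1)
    by_cases h2 : x.length + z.length ≤ (wpow z M).length
    · apply PairComm.of_reverse
      refine pairComm_of_xy (by omega) heqr (step_long heqr ?_)
      simpa [wpow_length] using h2
    have hyx : y.length < x.length := by
      rw [wpow_length] at h1; nlinarith
    have hzx : z.length < x.length := by
      rw [wpow_length] at h2; nlinarith
    have hlen : K * x.length = (wpow y L).length + (wpow z M).length := by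
      rw [← List.length_append, ← heq, wpow_length]
    rcases Nat.lt_or_ge K 3 with hK3 | hK3
    · obtain rfl : K = 2 := by omega
      by_cases h3 : x.length ≤ (wpow y L).length
      · exact step_two hL hM (fun x' y' z' K L M h => ih x' y' z' K L M (by omega)) heq h3
          (by omega) hyx
      · apply PairComm.of_reverse
        have e : (wpow z.reverse M).length = (wpow z M).length := by simp [wpow_length]
        refine step_two hM hL (fun x' y' z' K L M h => ih x' y' z' K L M
          (by rw [List.length_reverse] at h; omega)) heqr ?_ ?_ ?_
        · rw [e]; simp; omega
        · rw [e]; simp; omega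
        · simpa using hzx
    · obtain ⟨c, d, hx, hg⟩ := exists_good x
      have hcd : x.length = c.length + d.length := by rw [hx]; simp
      by_cases h3 : c.length + x.length ≤ (wpow y L).length
      · exact pairComm_of_xy (by omega) heq (step_three hK hL heq hx hg h3 hyx)
      · apply PairComm.of_reverse
        have e : (wpow z.reverse M).length = (wpow z M).length := by simp [wpow_length]
        refine pairComm_of_xy (by omega) heqr (step_three hK hM heqr
          (c := d.reverse) (d := c.reverse) (by rw [hx]; simp) ?_ ?_ (by simpa using hzx))
        · have := hg.reverse
          simpa using this
        · rw [e]; simp; nlinarith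

theorem root_step {x y z : List A} (hy : y ≠ []) (hyx : y.length ≤ x.length)
    (h : PairComm x y z)
    (IH : ∀ x' y' z' : List A, x'.length + y'.length + z'.length <
      x.length + y.length + z.length → PairComm x' y' z' →
      ∃ (α : List A) (k l m : ℕ), x' = wpow α k ∧ y' = wpow α l ∧ z' = wpow α m) :
    ∃ (α : List A) (k l m : ℕ), x = wpow α k ∧ y = wpow α l ∧ z = wpow α m := by
  obtain ⟨h1, h2, h3⟩ := h
  obtain ⟨x', rfl⟩ : y <+: x := List.prefix_of_prefix_length_le
    (List.prefix_append y x) (by rw [← h1]; exact List.prefix_append _ _) hyx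
  have hpos : 0 < y.length := List.length_pos_iff.2 hy
  have c1 : y ++ x' = x' ++ y := comm_cancel h1.symm rfl
  have c2 : z ++ x' = x' ++ z := comm_cancel h2.symm h3.symm
  obtain ⟨α, k, l, m, e1, e2, e3⟩ := IH x' y z (by simp; omega) ⟨c1.symm, c2.symm, h3⟩
  exact ⟨α, l + k, l, m, by rw [wpow_add, ← e1, ← e2], e2, e3⟩

theorem root_aux (n : ℕ) : ∀ x y z : List A, x.length + y.length + z.length < n →
      PairComm x y z →
      ∃ (α : List A) (k l m : ℕ), x = wpow α k ∧ y = wpow α l ∧ z = wpow α m := by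
  induction n with
  | zero => intro x y z h; omega
  | succ n ih =>
    -- the case where `x` is the longest
    have key : ∀ x y z : List A, x.length + y.length + z.length < n + 1 →
        PairComm x y z → y.length ≤ x.length → z.length ≤ x.length →
        ∃ (α : List A) (k l m : ℕ), x = wpow α k ∧ y = wpow α l ∧ z = wpow α m := by
      intro x y z hn h hy hz
      by_cases h1 : y = []
      · by_cases h2 : z = []
        · exact ⟨x, 1, 0, 0, by simp [wpow], by simpa [wpow] using h1, by simpa [wpow] using h2⟩
        · obtain ⟨α, k, l, m, e1, e2, e3⟩ := root_step (x := x) (y := z) (z := y) h2 hz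
            ⟨h.2.1, h.1, h.2.2.symm⟩ (fun x' y' z' hl => ih x' y' z' (by omega))
          exact ⟨α, k, m, l, e1, e3, e2⟩
      · exact root_step h1 hy h (fun x' y' z' hl => ih x' y' z' (by omega))
    intro x y z hn h
    by_cases h1 : y.length ≤ x.length ∧ z.length ≤ x.length
    · exact key x y z hn h h1.1 h1.2
    by_cases h2 : x.length ≤ y.length ∧ z.length ≤ y.length
    · obtain ⟨α, k, l, m, e1, e2, e3⟩ := key y x z (by omega) ⟨h.1.symm, h.2.2, h.2.1⟩ h2.1 h2.2
      exact ⟨α, l, k, m, e2, e1, e3⟩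
    · obtain ⟨α, k, l, m, e1, e2, e3⟩ := key z x y (by omega)
        ⟨h.2.1.symm, h.2.2.symm, h.1⟩ (by omega) (by omega)
      exact ⟨α, l, m, k, e2, e3, e1⟩

end LS

/-- Lyndon–Schützenberger: if `x ^ K = y ^ L ++ z ^ M` with `K, L, M ≥ 2`,
then `x`, `y`, `z` are all powers of a common word. -/
theorem lyndon_schutzenberger {A : Type*} (x y z : List A) (K L M : ℕ)
    (hK : 2 ≤ K) (hL : 2 ≤ L) (hM : 2 ≤ M)
    (heq : wpow x K = wpow y L ++ wpow z M) :
    ∃ (α : List A) (k l m : ℕ),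
      x = wpow α k ∧ y = wpow α l ∧ z = wpow α m := by
  obtain h := ls_aux (x.length + 1) x y z K L M (by omega) hK hL hM heq
  exact root_aux _ x y z (Nat.lt_succ_self _) h
end
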